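/- Fix a real number ζ₀ ∈ (0,1) and let h(t) = Σ_{i=1}^{t} ⌊i/2⌋. Let (ζ(K))_K be a sequence of natural numbers with ζ(K)/K → ζ₀ as K → ∞. Then lim_{K→∞} Σ_{ℓ=0}^{2K−2} ζ(K) / ((ℓ+1)K − h(ℓ+1)) · ∏_{t=1}^{ℓ} ( ζ(K) − ⌊t/2⌋ ) / ( tK − h(t) ) = e^{ζ₀} − 1, where the empty product (ℓ = 0) equals 1. -/

import Mathlib

open Filter

/-- `h(t) = Σ_{i=1}^t ⌊i/2⌋`. -/
def hfun (t : ℕ) : ℕ := ∑ i ∈ Finset.Icc 1 t, i / 2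

lemma four_mul_hfun_add_mod (t : ℕ) : 4 * hfun t + t % 2 = t * t := by
  induction t with
  | zero => simp [hfun]
  | succ t ih =>
    have h : hfun (t + 1) = hfun t + (t + 1) / 2 := by
      simp [hfun, Finset.sum_Icc_succ_top]
    have h' : (t + 1) * (t + 1) = t * t + 2 * t + 1 := by ring
    rw [h, h']
    omega

/-- For `t ≤ 2K` the denominator `tK - h(t)` is at least `tK/2`. -/
lemma half_mul_le_mul_sub_hfun {t K : ℕ} (ht : t ≤ 2 * K) :
    (t : ℝ) * K / 2 ≤ (t : ℝ) * K - hfun t := by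
  have h4 : 4 * (hfun t : ℝ) ≤ t * t := by
    have := four_mul_hfun_add_mod t
    exact_mod_cast (by omega : 4 * hfun t ≤ t * t)
  have htK : (t : ℝ) ≤ 2 * K := by exact_mod_cast ht
  nlinarith [mul_le_mul_of_nonneg_left htK (Nat.cast_nonneg (α := ℝ) t)]

lemma abs_div_mul_sub_hfun_le {t K : ℕ} {x : ℝ} (ht0 : 0 < t) (ht : t ≤ 2 * K) (hx : |x| ≤ K) :
    |x / ((t : ℝ) * K - hfun t)| ≤ 2 / t := by
  have hK : (0 : ℝ) < K := by exact_mod_cast (by omega : 0 < K)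
  have ht' : (0 : ℝ) < t := by exact_mod_cast ht0
  have hden := half_mul_le_mul_sub_hfun ht
  have hpos : (0 : ℝ) < t * K / 2 := by positivity
  rw [abs_div, abs_of_pos (hpos.trans_le hden)]
  calc |x| / ((t : ℝ) * K - hfun t) ≤ K / (t * K / 2) := by gcongr
    _ = 2 / t := by field_simp

lemma prod_Icc_div_natCast (c : ℝ) (n : ℕ) :
    ∏ t ∈ Finset.Icc 1 n, c / (t : ℝ) = c ^ n / (n.factorial : ℝ) := by
  induction n with
  | zero => simp
  | succ n ih =>
    rw [Finset.prod_Icc_succ_top (by omega), ih, Nat.factorial_succ]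
    push_cast
    rw [div_mul_div_comm, pow_succ, mul_comm ((n : ℝ) + 1)]

lemma div_mul_prod_Icc_div_natCast (c : ℝ) (n : ℕ) :
    c / ((n : ℝ) + 1) * ∏ t ∈ Finset.Icc 1 n, c / (t : ℝ) =
      c ^ (n + 1) / ((n + 1).factorial : ℝ) := by
  rw [← prod_Icc_div_natCast c (n + 1), Finset.prod_Icc_succ_top (by omega), mul_comm]
  push_cast
  rfl

lemma tendsto_sub_const_div_mul_sub_const {a : ℝ} {u : ℕ → ℝ}
    (hu : Tendsto (fun K : ℕ => u K / K) atTop (nhds a)) (b c : ℝ) {t : ℝ} (ht : t ≠ 0) :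
    Tendsto (fun K : ℕ => (u K - b) / (t * K - c)) atTop (nhds (a / t)) := by
  have hlim : Tendsto (fun K : ℕ => (u K / K - b / K) / (t - c / K)) atTop
      (nhds ((a - 0) / (t - 0))) :=
    (hu.sub (tendsto_const_div_atTop_nhds_zero_nat b)).div
      (tendsto_const_nhds.sub (tendsto_const_div_atTop_nhds_zero_nat c)) (by simpa using ht)
  rw [sub_zero, sub_zero] at hlim
  refine hlim.congr' ?_
  filter_upwards [eventually_gt_atTop 0] with K hK
  have hK' : (K : ℝ) ≠ 0 := by exact_mod_cast hK.ne'
  rw [← sub_div, ← mul_div_mul_right _ (t - c / K) hK', div_mul_cancel₀ _ hK', sub_mul,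
    div_mul_cancel₀ _ hK']

/-- Asymptotics of `L_K(ζ)`: if `ζ(K)/K → ζ₀ ∈ (0,1)`, then
`Σ_{ℓ=0}^{2K-2} ζ(K)/((ℓ+1)K - h(ℓ+1)) ∏_{t=1}^ℓ (ζ(K) - ⌊t/2⌋)/(tK - h(t))`
converges to `e^{ζ₀} - 1`. -/
theorem stmt17 (ζ₀ : ℝ) (h1 : 0 < ζ₀) (h2 : ζ₀ < 1) (ζ : ℕ → ℕ)
    (hζ : Tendsto (fun K : ℕ => (ζ K : ℝ) / K) atTop (nhds ζ₀)) :
    Tendsto (fun K : ℕ =>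
        ∑ ℓ ∈ Finset.range (2 * K - 1),
          (ζ K : ℝ) / (((ℓ : ℝ) + 1) * K - hfun (ℓ + 1)) *
            ∏ t ∈ Finset.Icc 1 ℓ,
              ((ζ K : ℝ) - (t / 2 : ℕ)) / ((t : ℝ) * K - hfun t))
      atTop (nhds (Real.exp ζ₀ - 1)) := by
  set F : ℕ → ℕ → ℝ := fun K ℓ =>
    (ζ K : ℝ) / (((ℓ : ℝ) + 1) * K - hfun (ℓ + 1)) *
      ∏ t ∈ Finset.Icc 1 ℓ, ((ζ K : ℝ) - (t / 2 : ℕ)) / ((t : ℝ) * K - hfun t) with hF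
  have hsum : ∑' ℓ : ℕ, ζ₀ ^ (ℓ + 1) / ((ℓ + 1).factorial : ℝ) = Real.exp ζ₀ - 1 := by
    have h := (Real.summable_pow_div_factorial ζ₀).tsum_eq_zero_add
    rw [Real.exp_eq_exp_ℝ, NormedSpace.exp_eq_tsum_div]
    simp only [h]
    simp
  have htsum : ∀ K, ∑ ℓ ∈ Finset.range (2 * K - 1), F K ℓ =
      ∑' ℓ, (Finset.range (2 * K - 1) : Set ℕ).indicator (F K) ℓ := fun K =>
    sum_eq_tsum_indicator _ _
  change Tendsto (fun K => ∑ ℓ ∈ Finset.range (2 * K - 1), F K ℓ) _ _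
  simp only [htsum]
  rw [← hsum]
  refine tendsto_tsum_of_dominated_convergence
    (bound := fun ℓ : ℕ => (2 : ℝ) ^ (ℓ + 1) / ((ℓ + 1).factorial : ℝ))
    ((summable_nat_add_iff 1).2 (Real.summable_pow_div_factorial 2)) ?_ ?_
  · intro ℓ
    have hlim : Tendsto (fun K => F K ℓ) atTop
        (nhds (ζ₀ / ((ℓ : ℝ) + 1) * ∏ t ∈ Finset.Icc 1 ℓ, ζ₀ / (t : ℝ))) := by
      refine Tendsto.mul ?_ (tendsto_finsetProd _ fun t ht => ?_)
      · simpa using tendsto_sub_const_div_mul_sub_const hζ 0 (hfun (ℓ + 1))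
          (Nat.cast_add_one_ne_zero ℓ)
      · have ht0 : t ≠ 0 := by have := (Finset.mem_Icc.1 ht).1; omega
        exact tendsto_sub_const_div_mul_sub_const hζ _ _ (Nat.cast_ne_zero.2 ht0)
    rw [div_mul_prod_Icc_div_natCast] at hlim
    refine hlim.congr' ?_
    filter_upwards [eventually_gt_atTop (ℓ + 1)] with K hK
    rw [Set.indicator_of_mem]
    simp only [Finset.coe_range, Set.mem_Iio]
    omega
  · filter_upwards [hζ.eventually_lt_const h2, eventually_gt_atTop 0] with K hζK hK ℓ
    have hζle : (ζ K : ℝ) ≤ K := by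
      rw [div_lt_one (by exact_mod_cast hK)] at hζK
      exact hζK.le
    by_cases hℓ : ℓ ∈ (Finset.range (2 * K - 1) : Set ℕ)
    · rw [Set.indicator_of_mem hℓ, ← div_mul_prod_Icc_div_natCast, Real.norm_eq_abs, hF]
      simp only [Finset.coe_range, Set.mem_Iio] at hℓ
      simp only [abs_mul, Finset.abs_prod]
      gcongr with t ht
      · have := abs_div_mul_sub_hfun_le (t := ℓ + 1) (K := K) (x := ζ K) (by omega) (by omega)
          (by rwa [Nat.abs_cast])
        push_cast at this
        exact this
      · obtain ⟨ht1, ht2⟩ := Finset.mem_Icc.1 ht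
        refine abs_div_mul_sub_hfun_le (by omega) (by omega) ?_
        have hhalf : ((t / 2 : ℕ) : ℝ) ≤ K := by exact_mod_cast (by omega : t / 2 ≤ K)
        rw [abs_le]
        constructor <;> linarith [Nat.cast_nonneg (α := ℝ) (ζ K),
          Nat.cast_nonneg (α := ℝ) (t / 2)]
    · rw [Set.indicator_of_notMem hℓ, norm_zero]
      positivity
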